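/- Let Q be a homogeneous harmonic polynomial on ℝ^n and let P be any polynomial such that Z(Q) ⊆ Z(P), where Z denotes the real zero set. Then Q divides P in ℝ[x₁,…,xₙ], i.e., there exists a polynomial R with P = Q·R. -/

import Mathlib

open MvPolynomial MeasureTheory ProbabilityTheory

theorem integrable_pow_mul_gaussianPDFReal (a : ℕ) :
    Integrable fun x : ℝ ↦ gaussianPDFReal 0 1 x * x ^ a := by
  have h := (integrable_rpow_mul_exp_neg_mul_sq (b := 1 / 2) (by norm_num) (s := a)
    (by linarith [a.cast_nonneg (α := ℝ)])).const_mul (√(2 * Real.pi * (1 : NNReal)))⁻¹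
  refine h.congr (ae_of_all _ fun x ↦ ?_)
  simp only [gaussianPDFReal, Real.rpow_natCast, NNReal.coe_one]
  ring_nf

theorem integrable_pow_gaussianReal (a : ℕ) :
    Integrable (fun x : ℝ ↦ x ^ a) (gaussianReal 0 1) :=
  ((memLp_id_gaussianReal a).integrable_norm_pow').mono' (by fun_prop)
    (ae_of_all _ fun x ↦ by simp)

theorem hasDerivAt_gaussianPDFReal (x : ℝ) :
    HasDerivAt (gaussianPDFReal 0 1) (-(x * gaussianPDFReal 0 1 x)) x := by
  have h : HasDerivAt (fun x : ℝ ↦ -(x - 0) ^ 2 / (2 * (1 : NNReal))) (-x) x := by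
    have := ((hasDerivAt_pow 2 x).neg).div_const 2
    simpa [neg_div] using this
  have := h.exp.const_mul (√(2 * Real.pi * (1 : NNReal)))⁻¹
  refine this.congr_deriv ?_
  simp only [gaussianPDFReal]
  ring

/-- The moment recursion of the standard Gaussian. -/
theorem integral_pow_succ_gaussianReal (a : ℕ) :
    ∫ x, x ^ (a + 1) ∂gaussianReal 0 1 = a * ∫ x, x ^ (a - 1) ∂gaussianReal 0 1 := by
  simp only [integral_gaussianReal_eq_integral_smul one_ne_zero, smul_eq_mul]
  have h₁ := (integrable_pow_mul_gaussianPDFReal (a - 1)).const_mul (a : ℝ)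
  have h₂ := integrable_pow_mul_gaussianPDFReal (a + 1)
  have h := integral_eq_zero_of_hasDerivAt_of_integrable
    (f' := fun x ↦ a * (gaussianPDFReal 0 1 x * x ^ (a - 1)) - gaussianPDFReal 0 1 x * x ^ (a + 1))
    (fun x ↦ ((hasDerivAt_gaussianPDFReal x).mul (hasDerivAt_pow a x)).congr_deriv (by ring))
    (h₁.sub h₂) (integrable_pow_mul_gaussianPDFReal a)
  rw [integral_sub h₁ h₂, integral_const_mul] at h
  linarith

instance isOpenPosMeasure_gaussianReal : (gaussianReal 0 1).IsOpenPosMeasure :=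
  (gaussianReal_absolutelyContinuous' 0 one_ne_zero).isOpenPosMeasure

theorem pderiv_comm {σ : Type*} (i j : σ) (p : MvPolynomial σ ℝ) :
    pderiv i (pderiv j p) = pderiv j (pderiv i p) := by
  classical
  have h : ⁅pderiv (R := ℝ) i, pderiv j⁆ = 0 := MvPolynomial.derivation_ext fun k ↦ by
    rw [Derivation.commutator_apply]
    simp [pderiv_X, Pi.single_apply, apply_ite]
  simpa [Derivation.commutator_apply, sub_eq_zero] using congr($h p)

section Gaussian

variable {σ : Type*} [Fintype σ]

theorem eval_monomial_eq_prod (s : σ →₀ ℕ) (c : ℝ) (x : σ → ℝ) :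
    eval x (monomial s c) = c * ∏ i, x i ^ s i := by
  rw [eval_monomial, Finsupp.prod_fintype _ _ fun i ↦ pow_zero _]

theorem integrable_eval_gaussian (p : MvPolynomial σ ℝ) :
    Integrable (fun x ↦ eval x p) (Measure.pi fun _ : σ ↦ gaussianReal 0 1) := by
  induction p using MvPolynomial.induction_on' with
  | monomial s c =>
    simp only [eval_monomial_eq_prod]
    exact (Integrable.fintype_prod fun i ↦ integrable_pow_gaussianReal (s i)).const_mul c
  | add p q hp hq =>
    simp only [map_add]
    exact hp.add hq

/-- The expectation of a polynomial under the standard Gaussian measure. -/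
noncomputable def gaussianExpectation : MvPolynomial σ ℝ →ₗ[ℝ] ℝ where
  toFun p := ∫ x, eval x p ∂Measure.pi fun _ : σ ↦ gaussianReal 0 1
  map_add' p q := by
    simpa using integral_add (integrable_eval_gaussian p) (integrable_eval_gaussian q)
  map_smul' c p := by
    simp [smul_eval, integral_const_mul]

theorem gaussianExpectation_monomial (s : σ →₀ ℕ) (c : ℝ) :
    gaussianExpectation (monomial s c) = c * ∏ i, ∫ x, x ^ s i ∂gaussianReal 0 1 := by
  simp only [gaussianExpectation, LinearMap.coe_mk, AddHom.coe_mk, eval_monomial_eq_prod,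
    integral_const_mul]
  rw [integral_fintype_prod_eq_prod (fun i x ↦ x ^ s i)]

/-- Gaussian integration by parts. -/
theorem gaussianExpectation_X_mul (i : σ) (p : MvPolynomial σ ℝ) :
    gaussianExpectation (X i * p) = gaussianExpectation (pderiv i p) := by
  classical
  induction p using MvPolynomial.induction_on' with
  | add p q hp hq => simp only [mul_add, map_add, hp, hq]
  | monomial s c =>
    have h : ∀ j ∈ Finset.univ.erase i,
        ∫ x, x ^ (Finsupp.single i 1 + s : σ →₀ ℕ) j ∂gaussianReal 0 1 =
          ∫ x, x ^ (s - Finsupp.single i 1 : σ →₀ ℕ) j ∂gaussianReal 0 1 := fun j hj ↦ by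
      simp [(Finset.ne_of_mem_erase hj).symm]
    rw [pderiv_monomial, X, monomial_mul, gaussianExpectation_monomial,
      gaussianExpectation_monomial, ← Finset.mul_prod_erase _ _ (Finset.mem_univ i),
      ← Finset.mul_prod_erase (a := i) Finset.univ
        (fun j ↦ ∫ x, x ^ (s - Finsupp.single i 1 : σ →₀ ℕ) j ∂gaussianReal 0 1)
        (Finset.mem_univ i), Finset.prod_congr rfl h]
    simp only [Finsupp.add_apply, Finsupp.tsub_apply, Finsupp.single_eq_same, add_comm 1,
      integral_pow_succ_gaussianReal]
    ring

theorem gaussianExpectation_pos {p : MvPolynomial σ ℝ} (hp : p ≠ 0) (h : ∀ x, 0 ≤ eval x p) :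
    0 < gaussianExpectation p := by
  obtain ⟨x, hx⟩ : ∃ x, eval x p ≠ 0 := by
    by_contra! h0
    exact hp (MvPolynomial.funext fun x ↦ by simpa using h0 x)
  exact integral_pos_of_integrable_nonneg_nonzero (MvPolynomial.continuous_eval p)
    (integrable_eval_gaussian p) h hx

theorem gaussianExpectation_harmonic_mul_homogeneous {k m : ℕ} (hmk : m < k)
    {Q G : MvPolynomial σ ℝ} (hQ : Q.IsHomogeneous k)
    (hharm : ∑ i, pderiv i (pderiv i Q) = 0) (hG : G.IsHomogeneous m) :
    gaussianExpectation (Q * G) = 0 := by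
  induction k generalizing m Q G with
  | zero => omega
  | succ k ih =>
    have hterm (i : σ) : gaussianExpectation (pderiv i Q * pderiv i G) = 0 := by
      cases m with
      | zero =>
        rw [← totalDegree_zero_iff_isHomogeneous, totalDegree_eq_zero_iff_eq_C] at hG
        rw [hG, pderiv_C, mul_zero, map_zero]
      | succ m =>
        refine ih (by omega) hQ.pderiv ?_ hG.pderiv
        simp_rw [pderiv_comm _ i, ← map_sum, hharm, map_zero]
    have heuler : (k + 1 : ℕ) • (Q * G) = ∑ i, X i * (pderiv i Q * G) := by
      rw [← smul_mul_assoc, ← hQ.sum_X_mul_pderiv, Finset.sum_mul]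
      simp only [mul_assoc]
    have h : ((k + 1 : ℕ) : ℝ) * gaussianExpectation (Q * G) = 0 := by
      rw [← nsmul_eq_mul, ← map_nsmul, heuler, map_sum]
      simp only [gaussianExpectation_X_mul, pderiv_mul, map_add, hterm, add_zero]
      rw [← map_sum, ← Finset.sum_mul, hharm, zero_mul, map_zero]
    exact (mul_eq_zero.mp h).resolve_left (by positivity)

/-- A harmonic form is Gaussian-orthogonal to every polynomial of smaller degree. -/
theorem gaussianExpectation_harmonic_mul {k : ℕ} {Q G : MvPolynomial σ ℝ} (hQ : Q.IsHomogeneous k)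
    (hharm : ∑ i, pderiv i (pderiv i Q) = 0) (hG : G.totalDegree < k) :
    gaussianExpectation (Q * G) = 0 := by
  rw [← sum_homogeneousComponent G, Finset.mul_sum, map_sum]
  refine Finset.sum_eq_zero fun m hm ↦ ?_
  exact gaussianExpectation_harmonic_mul_homogeneous (by grind) hQ hharm
    (homogeneousComponent_isHomogeneous m G)

/-- A nonnegative factor of a nonzero harmonic form is constant. -/
theorem isUnit_of_nonneg_of_dvd_harmonic {k : ℕ} {Q F : MvPolynomial σ ℝ} (hQ0 : Q ≠ 0)
    (hQ : Q.IsHomogeneous k) (hharm : ∑ i, pderiv i (pderiv i Q) = 0)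
    (hF : ∀ x, 0 ≤ eval x F) (hFQ : F ∣ Q) : IsUnit F := by
  obtain ⟨G, rfl⟩ := hFQ
  obtain ⟨hF0, hG0⟩ := mul_ne_zero_iff.mp hQ0
  by_contra hu
  have hdeg : F.totalDegree ≠ 0 := fun h ↦ by
    rw [totalDegree_eq_zero_iff_eq_C] at h
    refine hu (h ▸ (IsUnit.mk0 _ fun h0 ↦ hF0 ?_).map C)
    rw [h, h0, C_0]
  have hk := hQ.totalDegree hQ0
  rw [totalDegree_mul_of_isDomain hF0 hG0] at hk
  refine (gaussianExpectation_pos (p := F * G * G) (mul_ne_zero hQ0 hG0) fun x ↦ ?_).ne'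
    (gaussianExpectation_harmonic_mul hQ hharm (by omega))
  rw [map_mul, map_mul, mul_assoc]
  exact mul_nonneg (hF x) (mul_self_nonneg _)

end Gaussian

section SignChange

variable {σ : Type*}

/-- Gauss's lemma and Bézout: elimination of the variable. -/
theorem exists_combination_eq_C {R : Type*} [CommRing R] [IsDomain R] [UniqueFactorizationMonoid R]
    {p q : Polynomial R} (hp : Irreducible p) (hdeg : p.natDegree ≠ 0) (hpq : ¬ p ∣ q) :
    ∃ (a b : Polynomial R) (c : R), c ≠ 0 ∧ a * p + b * q = Polynomial.C c := by
  classical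
  let _ : NormalizedGCDMonoid R := Nonempty.some inferInstance
  let K := FractionRing R
  have hprim := hp.isPrimitive hdeg
  have hK := (hprim.irreducible_iff_irreducible_map_fraction_map (K := K)).mp hp
  obtain ⟨a, b, hab⟩ := hK.coprime_iff_not_dvd.mpr
    fun h : _ ∣ q.map (algebraMap R K) ↦ hpq (hprim.dvd_of_fraction_map_dvd_fraction_map (K := K) h)
  obtain ⟨r, hr, ha⟩ := IsLocalization.integerNormalization_spec (nonZeroDivisors R) a
  obtain ⟨s, hs, hb⟩ := IsLocalization.integerNormalization_spec (nonZeroDivisors R) b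
  refine ⟨Polynomial.C s * IsLocalization.integerNormalization (nonZeroDivisors R) a,
    Polynomial.C r * IsLocalization.integerNormalization (nonZeroDivisors R) b, r * s,
    mul_ne_zero (nonZeroDivisors.ne_zero hr) (nonZeroDivisors.ne_zero hs), ?_⟩
  apply Polynomial.map_injective _ (IsFractionRing.injective R K)
  simp only [Polynomial.map_add, Polynomial.map_mul, ha, hb, Polynomial.map_C, map_mul,
    Algebra.smul_def, Polynomial.algebraMap_apply]
  linear_combination Polynomial.C (algebraMap R K r) * Polynomial.C (algebraMap R K s) * hab

/-- The substitution `x ↦ x + t v`, with values in polynomials in `t`. -/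
noncomputable def lineShift (v : σ → ℝ) :
    MvPolynomial σ ℝ →+* Polynomial (MvPolynomial σ ℝ) :=
  eval₂Hom (Polynomial.C.comp C) fun i ↦ Polynomial.C (X i) + Polynomial.C (C (v i)) * Polynomial.X

theorem eval_lineShift (v y : σ → ℝ) (t : ℝ) (p : MvPolynomial σ ℝ) :
    ((lineShift v p).map (eval y)).eval t = eval (y + t • v) p := by
  have h : ((Polynomial.evalRingHom t).comp (Polynomial.mapRingHom (eval y))).comp (lineShift v) =
      eval (y + t • v) := by
    refine MvPolynomial.ringHom_ext (fun r ↦ ?_) fun i ↦ ?_ <;> simp [lineShift, mul_comm t]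
  exact congr($h p)

/-- The extension of `lineShift v` to an endomorphism fixing `t`. -/
noncomputable def lineShiftHom (v : σ → ℝ) :
    Polynomial (MvPolynomial σ ℝ) →+* Polynomial (MvPolynomial σ ℝ) :=
  Polynomial.eval₂RingHom (lineShift v) Polynomial.X

theorem lineShiftHom_comp_neg (v : σ → ℝ) :
    (lineShiftHom v).comp (lineShiftHom (-v)) = RingHom.id _ := by
  refine Polynomial.ringHom_ext' (MvPolynomial.ringHom_ext (fun r ↦ ?_) fun i ↦ ?_) ?_ <;>
    simp [lineShiftHom, lineShift, add_assoc, ← add_mul]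

/-- The automorphism of `ℝ[x][t]` sending `x` to `x + t v` and fixing `t`. -/
noncomputable def lineShiftEquiv (v : σ → ℝ) :
    Polynomial (MvPolynomial σ ℝ) ≃+* Polynomial (MvPolynomial σ ℝ) :=
  RingEquiv.ofRingHom (lineShiftHom v) (lineShiftHom (-v)) (lineShiftHom_comp_neg v)
    (by simpa using lineShiftHom_comp_neg (-v))

theorem lineShiftEquiv_C (v : σ → ℝ) (p : MvPolynomial σ ℝ) :
    lineShiftEquiv v (Polynomial.C p) = lineShift v p := by
  simp [lineShiftEquiv, lineShiftHom]

theorem irreducible_lineShift (v : σ → ℝ) {p : MvPolynomial σ ℝ} (hp : Irreducible p) :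
    Irreducible (lineShift v p) := by
  rw [← lineShiftEquiv_C]
  exact (MulEquiv.irreducible_iff (lineShiftEquiv v)).mpr
    (Polynomial.prime_C_iff.mpr hp.prime).irreducible

theorem lineShift_dvd_lineShift (v : σ → ℝ) {p q : MvPolynomial σ ℝ} :
    lineShift v p ∣ lineShift v q ↔ p ∣ q := by
  rw [← lineShiftEquiv_C, ← lineShiftEquiv_C, map_dvd_iff]
  exact ⟨fun h ↦ by simpa using map_dvd Polynomial.constantCoeff h, map_dvd Polynomial.C⟩

/-- The sign-change criterion: an irreducible real polynomial taking both signs divides every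
polynomial vanishing on its zero set. -/
theorem dvd_of_irreducible_of_sign_change [Finite σ] {E P : MvPolynomial σ ℝ} (hE : Irreducible E)
    {a b : σ → ℝ} (ha : 0 < eval a E) (hb : eval b E < 0)
    (hZ : ∀ x, eval x E = 0 → eval x P = 0) : E ∣ P := by
  have := Fintype.ofFinite σ
  by_contra hdvd
  set v := b - a with hv
  have hdeg : (lineShift v E).natDegree ≠ 0 := fun h ↦ by
    obtain ⟨c, hc⟩ := Polynomial.natDegree_eq_zero.mp h
    have h0 := eval_lineShift v a 0 E
    have h1 := eval_lineShift v a 1 E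
    rw [← hc] at h0 h1
    simp [hv] at h0 h1
    linarith
  obtain ⟨A, B, c, hc, hAB⟩ := exists_combination_eq_C (irreducible_lineShift v hE) hdeg
    (mt (lineShift_dvd_lineShift v).mp hdvd)
  have hopen : IsOpen {y : σ → ℝ | 0 < eval y E ∧ eval (y + v) E < 0} := by
    refine IsOpen.inter ?_ ?_
    · exact isOpen_lt continuous_const (MvPolynomial.continuous_eval E)
    · exact isOpen_lt ((MvPolynomial.continuous_eval E).comp (by fun_prop)) continuous_const
  obtain ⟨ε, hε, hball⟩ := Metric.isOpen_iff.mp hopen a ⟨ha, by simpa [hv] using hb⟩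
  refine hc (funext_set (fun i ↦ Metric.ball (a i) ε)
    (fun i ↦ by rw [Real.ball_eq_Ioo]; exact Set.Ioo_infinite (by linarith)) fun y hy ↦ ?_)
  rw [← ball_pi _ hε] at hy
  obtain ⟨h0, h1⟩ := hball hy
  have hcont : Continuous fun t : ℝ ↦ eval (y + t • v) E :=
    (MvPolynomial.continuous_eval E).comp (by fun_prop)
  obtain ⟨t, -, ht⟩ := intermediate_value_Icc' zero_le_one hcont.continuousOn
    (show (0 : ℝ) ∈ _ from ⟨by simpa using h1.le, by simpa using h0.le⟩)
  have := congr(($hAB |>.map (eval y)).eval t)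
  simpa [eval_lineShift, ht, hZ _ ht] using this.symm

theorem dvd_of_squarefree_of_irreducible_dvd {R : Type*} [CommRing R] [IsDomain R]
    [UniqueFactorizationMonoid R] {x y : R} (hx : Squarefree x)
    (h : ∀ p, Irreducible p → p ∣ x → p ∣ y) : x ∣ y := by
  induction x using UniqueFactorizationMonoid.induction_on_prime with
  | h₁ => exact absurd hx not_squarefree_zero
  | h₂ x hu => exact hu.dvd
  | h₃ a p ha hp ih =>
    exact (IsRelPrime.of_squarefree_mul hx).mul_dvd (h p hp.irreducible (dvd_mul_right _ _))
      (ih (hx.squarefree_of_dvd (dvd_mul_left _ _)) fun q hq hqa ↦ h q hq (hqa.mul_left _))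

end SignChange

/-- Division lemma: if `Q` is a homogeneous harmonic polynomial and `P` is any
polynomial whose real zero set contains that of `Q`, then `Q` divides `P`. -/
theorem stmt3 {n k : ℕ} (Q P : MvPolynomial (Fin n) ℝ)
    (hhom : Q.IsHomogeneous k)
    (hharm : ∑ i : Fin n, pderiv i (pderiv i Q) = 0)
    (hZ : ∀ x : Fin n → ℝ, eval x Q = 0 → eval x P = 0) :
    ∃ R : MvPolynomial (Fin n) ℝ, P = Q * R := by
  rcases eq_or_ne Q 0 with rfl | hQ0
  · exact ⟨0, MvPolynomial.funext fun x ↦ by simpa using hZ x (by simp)⟩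
  have hunit {F : MvPolynomial (Fin n) ℝ} (hF : ∀ x, 0 ≤ eval x F) (hFQ : F ∣ Q) : IsUnit F :=
    isUnit_of_nonneg_of_dvd_harmonic hQ0 hhom hharm hF hFQ
  have hsq : Squarefree Q := fun E hE ↦
    isUnit_of_mul_isUnit_left (hunit (fun x ↦ by simpa using mul_self_nonneg (eval x E)) hE)
  refine dvd_of_squarefree_of_irreducible_dvd hsq fun E hE hEQ ↦ ?_
  obtain ⟨b, hb⟩ : ∃ b, eval b E < 0 := by
    by_contra! h
    exact hE.not_isUnit (hunit h hEQ)
  obtain ⟨a, ha⟩ : ∃ a, 0 < eval a E := by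
    by_contra! h
    exact hE.not_isUnit (IsUnit.neg_iff E |>.mp
      (hunit (fun x ↦ by simpa using h x) (neg_dvd.mpr hEQ)))
  refine dvd_of_irreducible_of_sign_change hE ha hb fun x hx ↦ hZ x ?_
  obtain ⟨H, rfl⟩ := hEQ
  simp [hx]
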